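/- Let 0 < λ < 1 and let f, g, h : ℝⁿ → [0,∞) be integrable functions satisfying h((1-λ)x + λy) ≥ f(x)^{1-λ} g(y)^{λ} for all x, y ∈ ℝⁿ. Then ∫ h ≥ (∫ f)^{1-λ} (∫ g)^{λ}. -/

import Mathlib

open MeasureTheory Set Function

noncomputable section

abbrev En (n : ℕ) := EuclideanSpace ℝ (Fin n)

theorem bm_cpt {K L C : Set ℝ} (hK : IsCompact K) (hL : IsCompact L) (hK0 : K.Nonempty)
    (hL0 : L.Nonempty) (h : ∀ a ∈ K, ∀ b ∈ L, a + b ∈ C) :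
    volume K + volume L ≤ volume C := by
  obtain ⟨a, ha⟩ := hK.exists_isGreatest hK0
  obtain ⟨b, hb⟩ := hL.exists_isLeast hL0
  have h1 : volume ((fun x => x + b) '' K) = volume K := by
    simp
  have h2 : volume ((fun x => a + x) '' L) = volume L := by
    simp
  have hm : IsCompact ((fun x => a + x) '' L) := hL.image (by fun_prop)
  rw [← h1, ← h2, ← measure_union₀ hm.measurableSet.nullMeasurableSet]
  · apply measure_mono
    rintro _ (⟨x, hx, rfl⟩ | ⟨x, hx, rfl⟩)
    · exact h x hx b hb.1
    · exact h a ha.1 x hx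
  · refine measure_mono_null (t := {a + b}) ?_ (by simp)
    rintro _ ⟨⟨x, hx, rfl⟩, ⟨y, hy, hxy⟩⟩
    have := ha.2 hx
    have := hb.2 hy
    simp only [mem_singleton_iff] at *
    linarith

theorem bm_add {A B C : Set ℝ} (hA : MeasurableSet A) (hB : MeasurableSet B) (hA0 : A.Nonempty)
    (hB0 : B.Nonempty) (h : ∀ a ∈ A, ∀ b ∈ B, a + b ∈ C) :
    volume A + volume B ≤ volume C := by
  by_cases zA : volume A = 0
  · obtain ⟨a, ha⟩ := hA0
    have h2 : volume ((fun x => a + x) '' B) = volume B := by simp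
    rw [zA, zero_add, ← h2]
    apply measure_mono
    rintro _ ⟨x, hx, rfl⟩
    exact h a ha x hx
  by_cases zB : volume B = 0
  · obtain ⟨b, hb⟩ := hB0
    have h2 : volume ((fun x => x + b) '' A) = volume A := by simp
    rw [zB, add_zero, ← h2]
    apply measure_mono
    rintro _ ⟨x, hx, rfl⟩
    exact h x hx b hb
  refine le_of_forall_lt fun c hc => ?_
  obtain ⟨r, hr, s, hs, hrs⟩ := ENNReal.exists_lt_add_of_lt_add hc zA zB
  obtain ⟨K, hKA, hK, hrK⟩ := hA.exists_lt_isCompact hr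
  obtain ⟨L, hLB, hL, hsL⟩ := hB.exists_lt_isCompact hs
  have hK0 : K.Nonempty := nonempty_of_measure_ne_zero (bot_lt_of_lt hrK).ne'
  have hL0 : L.Nonempty := nonempty_of_measure_ne_zero (bot_lt_of_lt hsL).ne'
  calc c < r + s := hrs
    _ ≤ volume K + volume L := by gcongr
    _ ≤ _ := bm_cpt hK hL hK0 hL0 fun a ha b hb => h a (hKA ha) b (hLB hb)

theorem bm_conv {A B C : Set ℝ} (t : ℝ) (ht0 : 0 < t) (ht1 : t < 1)
    (hA : MeasurableSet A) (hB : MeasurableSet B) (hA0 : A.Nonempty)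
    (hB0 : B.Nonempty) (h : ∀ a ∈ A, ∀ b ∈ B, (1 - t) * a + t * b ∈ C) :
    ENNReal.ofReal (1 - t) * volume A + ENNReal.ofReal t * volume B ≤ volume C := by
  open Pointwise in
  have h1 : volume ((1 - t) • A) = ENNReal.ofReal (1 - t) * volume A := by
    rw [Measure.addHaar_smul_of_nonneg _ (by linarith)]; simp
  open Pointwise in
  have h2 : volume (t • B) = ENNReal.ofReal t * volume B := by
    rw [Measure.addHaar_smul_of_nonneg _ (by linarith)]; simp
  rw [← h1, ← h2]
  apply bm_add (hA.const_smul₀ _) (hB.const_smul₀ _) hA0.smul_set hB0.smul_set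
  rintro _ ⟨a, ha, rfl⟩ _ ⟨b, hb, rfl⟩
  exact h a ha b hb

open scoped ENNReal

theorem amgm (t : ℝ) (ht0 : 0 < t) (ht1 : t < 1) (a b : ℝ≥0∞) :
    a ^ (1 - t) * b ^ t ≤ ENNReal.ofReal (1 - t) * a + ENNReal.ofReal t * b := by
  have hpq : (1 - t)⁻¹.HolderConjugate t⁻¹ := by
    rw [Real.holderConjugate_iff]
    exact ⟨(one_lt_inv₀ (by linarith)).2 (by linarith), by simp⟩
  have := ENNReal.young_inequality (a ^ (1 - t)) (b ^ t) hpq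
  rw [← ENNReal.rpow_mul, ← ENNReal.rpow_mul, mul_inv_cancel₀ (by linarith), mul_inv_cancel₀ ht0.ne',
    ENNReal.rpow_one, ENNReal.rpow_one, ENNReal.ofReal_inv_of_pos (by linarith),
    ENNReal.ofReal_inv_of_pos ht0, div_eq_mul_inv, div_eq_mul_inv, inv_inv, inv_inv] at this
  rwa [mul_comm a, mul_comm b] at this

theorem layer (f : ℝ → ℝ≥0∞) (hf : Measurable f) (hf1 : ∀ x, f x ≤ 1) :
    ∫⁻ x, f x = ∫⁻ s in Ioi (0:ℝ), volume {x | ENNReal.ofReal s < f x} := by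
  have h1 : ∀ x, f x ≠ ∞ := fun x => ((hf1 x).trans_lt ENNReal.one_lt_top).ne
  have := lintegral_eq_lintegral_meas_lt (volume : Measure ℝ) (f := fun x => (f x).toReal)
    (Filter.Eventually.of_forall fun x => ENNReal.toReal_nonneg) hf.ennreal_toReal.aemeasurable
  simp only [ENNReal.ofReal_toReal (h1 _)] at this
  rw [this]
  refine setLIntegral_congr_fun measurableSet_Ioi fun s hs => ?_
  simp only [ENNReal.ofReal_lt_iff_lt_toReal (le_of_lt hs) (h1 _)]

theorem pl_norm (t : ℝ) (ht0 : 0 < t) (ht1 : t < 1) (f g h : ℝ → ℝ≥0∞)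
    (hf : Measurable f) (hg : Measurable g) (hh : Measurable h)
    (hf1 : ∀ x, f x ≤ 1) (hg1 : ∀ x, g x ≤ 1)
    (hfs : ∀ s < 1, ∃ x, s < f x) (hgs : ∀ s < 1, ∃ x, s < g x)
    (hc : ∀ x y, f x ^ (1 - t) * g y ^ t ≤ h ((1 - t) * x + t * y)) :
    (∫⁻ x, f x) ^ (1 - t) * (∫⁻ x, g x) ^ t ≤ ∫⁻ x, h x := by
  refine (amgm t ht0 ht1 _ _).trans ?_
  have ht2 : 0 < 1 - t := by linarith
  trans ∫⁻ x, min (h x) 1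
  swap
  · exact lintegral_mono fun x => min_le_left _ _
  rw [layer f hf hf1, layer g hg hg1, layer _ (hh.min measurable_const) (fun x => min_le_right _ _)]
  have hm : ∀ f : ℝ → ℝ≥0∞, Measurable fun s : ℝ => volume {x | ENNReal.ofReal s < f x} := by
    intro f
    apply Antitone.measurable
    intro a b hab
    exact measure_mono fun x hx => lt_of_le_of_lt (ENNReal.ofReal_le_ofReal hab) hx
  rw [← lintegral_const_mul _ (hm f), ← lintegral_const_mul _ (hm g), ← lintegral_add_left
    ((hm f).const_mul _)]
  refine setLIntegral_mono' measurableSet_Ioi fun s hs => ?_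
  rcases lt_or_ge s 1 with h1 | h1
  · have h1' : ENNReal.ofReal s < 1 := by simpa using h1
    apply bm_conv t ht0 ht1 (measurableSet_lt measurable_const hf)
      (measurableSet_lt measurable_const hg) (hfs _ h1') (hgs _ h1')
    intro a ha b hb
    refine lt_min (lt_of_lt_of_le ?_ (hc a b)) h1'
    have hs0 : ENNReal.ofReal s ≠ 0 := by simpa using hs
    calc ENNReal.ofReal s = ENNReal.ofReal s ^ (1 - t) * ENNReal.ofReal s ^ t := by
          rw [← ENNReal.rpow_add _ _ hs0 ENNReal.ofReal_ne_top]; simp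
      _ < _ := ENNReal.mul_lt_mul (ENNReal.rpow_lt_rpow ha ht2) (ENNReal.rpow_lt_rpow hb ht0)
  · have h1' : 1 ≤ ENNReal.ofReal s := by simpa using h1
    have : ∀ f : ℝ → ℝ≥0∞, (∀ x, f x ≤ 1) → {x | ENNReal.ofReal s < f x} = ∅ := by
      intro f hf
      ext x
      simpa using (hf x).trans h1'
    simp [this f hf1, this g hg1]

theorem pl_bdd (t : ℝ) (ht0 : 0 < t) (ht1 : t < 1) (f g h : ℝ → ℝ≥0∞)
    (hf : Measurable f) (hg : Measurable g) (hh : Measurable h) (c : ℝ≥0∞) (hcc : c ≠ ∞)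
    (hf1 : ∀ x, f x ≤ c) (hg1 : ∀ x, g x ≤ c)
    (hc : ∀ x y, f x ^ (1 - t) * g y ^ t ≤ h ((1 - t) * x + t * y)) :
    (∫⁻ x, f x) ^ (1 - t) * (∫⁻ x, g x) ^ t ≤ ∫⁻ x, h x := by
  have ht2 : 0 < 1 - t := by linarith
  by_cases zf : ⨆ x, f x = 0
  · have : ∀ x, f x = 0 := by simpa using zf
    simp [this, ht2]
  by_cases zg : ⨆ x, g x = 0
  · have : ∀ x, g x = 0 := by simpa using zg
    simp [this, ht0]
  set M := ⨆ x, f x with hM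
  set N := ⨆ x, g x with hN
  have tM : M ≠ ∞ := ((iSup_le hf1).trans_lt hcc.lt_top).ne
  have tN : N ≠ ∞ := ((iSup_le hg1).trans_lt hcc.lt_top).ne
  have key : ∀ a b : ℝ≥0∞, (M⁻¹ * a) ^ (1 - t) * (N⁻¹ * b) ^ t =
      (M ^ (1 - t) * N ^ t)⁻¹ * (a ^ (1 - t) * b ^ t) := by
    intro a b
    rw [ENNReal.mul_rpow_of_nonneg _ _ ht2.le, ENNReal.mul_rpow_of_nonneg _ _ ht0.le,
      ENNReal.mul_inv (by simp [zf, ht1.le]) (by simp [tM, ht1.le]), ENNReal.inv_rpow,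
      ENNReal.inv_rpow]
    ring
  have hsup : ∀ f : ℝ → ℝ≥0∞, (⨆ x, f x) ≠ 0 → (⨆ x, f x) ≠ ∞ →
      ∀ s < 1, ∃ x, s < (⨆ x, f x)⁻¹ * f x := by
    intro f h0 h1 s hs
    have : s * (⨆ x, f x) < ⨆ x, f x := by
      simpa using ENNReal.mul_lt_mul_left h0 h1 hs
    obtain ⟨x, hx⟩ := lt_iSup_iff.1 this
    refine ⟨x, ?_⟩
    rw [mul_comm, ← div_eq_mul_inv]
    exact (ENNReal.lt_div_iff_mul_lt (Or.inl h0) (Or.inl h1)).2 hx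
  have := pl_norm t ht0 ht1 (fun x => M⁻¹ * f x) (fun x => N⁻¹ * g x)
    (fun x => (M ^ (1 - t) * N ^ t)⁻¹ * h x) (hf.const_mul _) (hg.const_mul _) (hh.const_mul _)
    (fun x => by
      rw [← ENNReal.inv_mul_cancel zf tM]; gcongr; exact le_iSup f x)
    (fun x => by
      rw [← ENNReal.inv_mul_cancel zg tN]; gcongr; exact le_iSup g x)
    (hsup f zf tM) (hsup g zg tN)
    (fun x y => by rw [key]; gcongr; exact hc x y)
  rw [lintegral_const_mul _ hf, lintegral_const_mul _ hg, lintegral_const_mul _ hh, key] at this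
  rwa [ENNReal.mul_le_mul_iff_right] at this
  · simp [ENNReal.mul_eq_top, tM, tN, zf, zg, ht0.le, ht2.le, ENNReal.rpow_eq_top_iff]
  · simp [zf, zg, tM, tN, ht0.le, ht2.le]

theorem pl_one (t : ℝ) (ht0 : 0 < t) (ht1 : t < 1) (f g h : ℝ → ℝ≥0∞)
    (hf : Measurable f) (hg : Measurable g) (hh : Measurable h)
    (hc : ∀ x y, f x ^ (1 - t) * g y ^ t ≤ h ((1 - t) * x + t * y)) :
    (∫⁻ x, f x) ^ (1 - t) * (∫⁻ x, g x) ^ t ≤ ∫⁻ x, h x := by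
  have ht2 : 0 < 1 - t := by linarith
  by_cases zf : ∫⁻ x, f x = 0
  · simp [zf, ht2]
  by_cases zg : ∫⁻ x, g x = 0
  · simp [zg, ht0]
  have lim : ∀ f : ℝ → ℝ≥0∞, Measurable f → Filter.Tendsto (fun n : ℕ => ∫⁻ x, min (f x) n)
      Filter.atTop (nhds (∫⁻ x, f x)) := by
    intro f hf
    apply lintegral_tendsto_of_tendsto_of_monotone
    · intro n; exact (hf.min measurable_const).aemeasurable
    · refine Filter.Eventually.of_forall fun x a b hab => ?_
      dsimp only
      gcongr
    · refine Filter.Eventually.of_forall fun x => ?_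
      have := (tendsto_const_nhds (x := f x)).min ENNReal.tendsto_nat_nhds_top
      simpa using this
  have l1 := ((ENNReal.continuous_rpow_const (y := 1 - t)).tendsto _).comp (lim f hf)
  have l2 := ((ENNReal.continuous_rpow_const (y := t)).tendsto _).comp (lim g hg)
  refine le_of_tendsto (ENNReal.Tendsto.mul l1 (Or.inl ?_) l2 (Or.inl ?_))
    (Filter.Eventually.of_forall fun n => ?_)
  · simp [zf, ht1.le]
  · simp [zg, ht0.le]
  · refine pl_bdd t ht0 ht1 _ _ h (hf.min measurable_const) (hg.min measurable_const) hh n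
      (by simp) (fun x => min_le_right _ _) (fun x => min_le_right _ _) fun x y => le_trans ?_ (hc x y)
    gcongr <;> exact min_le_left _ _

theorem pl_pi (t : ℝ) (ht0 : 0 < t) (ht1 : t < 1) (n : ℕ) : ∀ (f g h : (Fin n → ℝ) → ℝ≥0∞)
    (_ : Measurable f) (_ : Measurable g) (_ : Measurable h)
    (_ : ∀ x y, f x ^ (1 - t) * g y ^ t ≤ h ((1 - t) • x + t • y)),
    (∫⁻ x, f x) ^ (1 - t) * (∫⁻ x, g x) ^ t ≤ ∫⁻ x, h x := by
  induction n with
  | zero =>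
    intro f g h hf hg hh hc
    rw [Measure.volume_pi_eq_dirac 0, lintegral_dirac, lintegral_dirac, lintegral_dirac]
    simpa using hc 0 0
  | succ n ih =>
    intro f g h hf hg hh hc
    let e := (MeasurableEquiv.piFinSuccAbove (fun _ : Fin (n + 1) => ℝ) 0).symm
    have he : MeasurePreserving e :=
      (volume_preserving_piFinSuccAbove (fun _ : Fin (n + 1) => ℝ) 0).symm
    have fub : ∀ f : (Fin (n + 1) → ℝ) → ℝ≥0∞, Measurable f →
        ∫⁻ x, f x = ∫⁻ a, ∫⁻ y, f (e (a, y)) := by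
      intro f hf
      rw [← he.lintegral_comp hf, Measure.volume_eq_prod, lintegral_prod]
      exact (hf.comp e.measurable).aemeasurable
    have hme : ∀ f : (Fin (n + 1) → ℝ) → ℝ≥0∞, Measurable f →
        Measurable fun z => f (e z) := fun f hf => hf.comp e.measurable
    rw [fub f hf, fub g hg, fub h hh]
    refine pl_one t ht0 ht1 _ _ _ (hme f hf).lintegral_prod_right' (hme g hg).lintegral_prod_right'
      (hme h hh).lintegral_prod_right' fun a b => ?_
    refine ih _ _ _ ((hme f hf).comp measurable_prodMk_left) ((hme g hg).comp measurable_prodMk_left)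
      ((hme h hh).comp measurable_prodMk_left) fun x y => (hc _ _).trans (le_of_eq ?_)
    congr 1
    ext i
    refine Fin.cases ?_ (fun j => ?_) i <;>
      simp [e, MeasurableEquiv.piFinSuccAbove, Fin.insertNthEquiv]

/-- **The Prékopa–Leindler inequality** on `ℝⁿ`. -/
theorem prekopa_leindler {n : ℕ} (t : ℝ) (ht0 : 0 < t) (ht1 : t < 1)
    (f g h : En n → ℝ)
    (hf0 : ∀ x, 0 ≤ f x) (hg0 : ∀ x, 0 ≤ g x) (hh0 : ∀ x, 0 ≤ h x)
    (hfi : Integrable f) (hgi : Integrable g) (hhi : Integrable h)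
    (hcond : ∀ x y, f x ^ (1 - t) * g y ^ t ≤ h ((1 - t) • x + t • y)) :
    (∫ x, f x) ^ (1 - t) * (∫ x, g x) ^ t ≤ ∫ x, h x := by
  have ht2 : 0 < 1 - t := by linarith
  have iF := ofReal_integral_eq_lintegral_ofReal hfi (Filter.Eventually.of_forall hf0)
  have iG := ofReal_integral_eq_lintegral_ofReal hgi (Filter.Eventually.of_forall hg0)
  have iH := ofReal_integral_eq_lintegral_ofReal hhi (Filter.Eventually.of_forall hh0)
  have F0 : 0 ≤ ∫ x, f x := integral_nonneg hf0
  have G0 : 0 ≤ ∫ x, g x := integral_nonneg hg0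
  have H0 : 0 ≤ ∫ x, h x := integral_nonneg hh0
  rw [← ENNReal.ofReal_le_ofReal_iff H0, ENNReal.ofReal_mul (by positivity),
    ← ENNReal.ofReal_rpow_of_nonneg F0 ht2.le, ← ENNReal.ofReal_rpow_of_nonneg G0 ht0.le,
    iF, iG, iH]
  obtain ⟨f', hf', hff, ef⟩ := exists_measurable_le_lintegral_eq volume fun x => ENNReal.ofReal (f x)
  obtain ⟨g', hg', hgg, eg⟩ := exists_measurable_le_lintegral_eq volume fun x => ENNReal.ofReal (g x)
  obtain ⟨h', hh', hhh, eh⟩ : ∃ h' : En n → ℝ≥0∞, Measurable h' ∧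
      (∀ x, ENNReal.ofReal (h x) ≤ h' x) ∧ ∫⁻ x, ENNReal.ofReal (h x) = ∫⁻ x, h' x := by
    have hm : AEMeasurable (fun x => ENNReal.ofReal (h x)) := hhi.aemeasurable.ennreal_ofReal
    obtain ⟨k, hk, hek⟩ := hm
    obtain ⟨S, hS, hSm, hS0⟩ := exists_measurable_superset_of_null (ae_iff.1 hek)
    classical
    refine ⟨S.piecewise (fun _ => ∞) k, Measurable.piecewise hSm measurable_const hk, ?_, ?_⟩
    · intro x
      by_cases hx : x ∈ S
      · simp [hx]
      · have : ENNReal.ofReal (h x) = k x := by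
          by_contra hne
          exact hx (hS hne)
        simp [hx, this]
    · rw [lintegral_congr_ae hek]
      apply lintegral_congr_ae
      have : ∀ᵐ x, x ∉ S := measure_eq_zero_iff_ae_notMem.1 hS0
      filter_upwards [this] with x hx
      simp [hx]
  rw [ef, eg, eh]
  have hp := PiLp.volume_preserving_toLp (Fin n)
  rw [← hp.lintegral_comp hf', ← hp.lintegral_comp hg', ← hp.lintegral_comp hh']
  refine pl_pi t ht0 ht1 n _ _ _ (hf'.comp hp.measurable) (hg'.comp hp.measurable)
    (hh'.comp hp.measurable) fun x y => ?_
  refine le_trans ?_ (hhh _)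
  refine le_trans ?_ (ENNReal.ofReal_le_ofReal (hcond (WithLp.toLp 2 x) (WithLp.toLp 2 y)))
  rw [ENNReal.ofReal_mul (Real.rpow_nonneg (hf0 _) _),
    ← ENNReal.ofReal_rpow_of_nonneg (hf0 _) ht2.le, ← ENNReal.ofReal_rpow_of_nonneg (hg0 _) ht0.le]
  gcongr
  · exact hff _
  · exact hgg _

end
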